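/- (Theorem 3.1, uniform exponential-asymptotic stability) Under the standing hypotheses, if either C'(t) ≤ 0 for all t ≥ 0 or C'(t) → 0 as t → ∞, and if moreover sup_{t>0} g(t) < ∞, then the null solution is uniformly exponential-asymptotically stable: there exist κ ≥ 0 and positive constants δ, D, E such that for every t₀ ≥ κ every classical solution u on [t₀,∞) with d(t₀) < δ satisfies d(t) ≤ D·exp(−E(t − t₀))·d(t₀) for all t ≥ t₀. -/

import Mathlib

open Real Set MeasureTheory Filter

/-- A classical solution on `[t₀, ∞)` of the initial-boundary-value problem
`-ε(t) u_xxt + u_tt - C(t) u_xx + a' u_t = F(u) - a u_t` on `(0,π) × (t₀,∞)`,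
with Dirichlet boundary conditions `u(0,t) = u(π,t) = 0`.  The partial
derivatives are recorded as data, together with the hypotheses that they really
are the derivatives and that all of them are continuous on the closed
space-time domain. -/
structure ClassicalSolution (ε C F : ℝ → ℝ) (a' t₀ : ℝ) where
  u : ℝ → ℝ → ℝ
  ux : ℝ → ℝ → ℝ
  uxx : ℝ → ℝ → ℝ
  ut : ℝ → ℝ → ℝ
  utt : ℝ → ℝ → ℝ
  uxxt : ℝ → ℝ → ℝ
  aa : ℝ → ℝ → ℝ
  hux : ∀ t ∈ Ici t₀, ∀ x ∈ Icc (0:ℝ) π,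
    HasDerivWithinAt (fun y => u y t) (ux x t) (Icc 0 π) x
  huxx : ∀ t ∈ Ici t₀, ∀ x ∈ Icc (0:ℝ) π,
    HasDerivWithinAt (fun y => ux y t) (uxx x t) (Icc 0 π) x
  hut : ∀ x ∈ Icc (0:ℝ) π, ∀ t ∈ Ici t₀,
    HasDerivWithinAt (fun s => u x s) (ut x t) (Ici t₀) t
  hutt : ∀ x ∈ Icc (0:ℝ) π, ∀ t ∈ Ici t₀,
    HasDerivWithinAt (fun s => ut x s) (utt x t) (Ici t₀) t
  huxxt : ∀ x ∈ Icc (0:ℝ) π, ∀ t ∈ Ici t₀,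
    HasDerivWithinAt (fun s => uxx x s) (uxxt x t) (Ici t₀) t
  cont_u : ContinuousOn (Function.uncurry u) (Icc 0 π ×ˢ Ici t₀)
  cont_ux : ContinuousOn (Function.uncurry ux) (Icc 0 π ×ˢ Ici t₀)
  cont_uxx : ContinuousOn (Function.uncurry uxx) (Icc 0 π ×ˢ Ici t₀)
  cont_ut : ContinuousOn (Function.uncurry ut) (Icc 0 π ×ˢ Ici t₀)
  cont_utt : ContinuousOn (Function.uncurry utt) (Icc 0 π ×ˢ Ici t₀)
  cont_uxxt : ContinuousOn (Function.uncurry uxxt) (Icc 0 π ×ˢ Ici t₀)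
  cont_aa : ContinuousOn (Function.uncurry aa) (Icc 0 π ×ˢ Ici t₀)
  aa_nonneg : ∀ x ∈ Icc (0:ℝ) π, ∀ t ∈ Ici t₀, 0 ≤ aa x t
  pde : ∀ x ∈ Ioo (0:ℝ) π, ∀ t ∈ Ioi t₀,
    -(ε t) * uxxt x t + utt x t - C t * uxx x t + a' * ut x t
      = F (u x t) - aa x t * ut x t
  bc0 : ∀ t ∈ Ici t₀, u 0 t = 0
  bcπ : ∀ t ∈ Ici t₀, u π t = 0

/-- The time-dependent norm `d(t)` of a solution:
`d(t)² = ∫₀^π [ε(t)² u_xx² + u_x² + u² + u_t²] dx`. -/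
noncomputable def ClassicalSolution.d {ε C F : ℝ → ℝ} {a' t₀ : ℝ}
    (S : ClassicalSolution ε C F a' t₀) (t : ℝ) : ℝ :=
  Real.sqrt (∫ x in (0:ℝ)..π,
    ((ε t)^2 * (S.uxx x t)^2 + (S.ux x t)^2 + (S.u x t)^2 + (S.ut x t)^2))


lemma aux_ii {f : ℝ → ℝ} (hf : ContinuousOn f (Icc 0 π)) :
    IntervalIntegrable f volume 0 π :=
  ContinuousOn.intervalIntegrable_of_Icc pi_pos.le hf

lemma aux_lin {n : ℕ} (c : Fin n → ℝ) (f : Fin n → ℝ → ℝ)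
    (hf : ∀ i, ContinuousOn (f i) (Icc 0 π)) :
    ∫ x in (0:ℝ)..π, ∑ i, c i * f i x = ∑ i, c i * ∫ x in (0:ℝ)..π, f i x := by
  rw [intervalIntegral.integral_finsetSum]
  · simp
  · intro i _
    exact (aux_ii (hf i)).const_mul _

lemma aux_lin' {n : ℕ} (g : ℝ → ℝ) (c : Fin n → ℝ) (f : Fin n → ℝ → ℝ)
    (hf : ∀ i, ContinuousOn (f i) (Icc 0 π)) (hg : ∀ x, g x = ∑ i, c i * f i x) :
    ∫ x in (0:ℝ)..π, g x = ∑ i, c i * ∫ x in (0:ℝ)..π, f i x := by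
  rw [← aux_lin c f hf]
  simp only [hg]

lemma aux_parts {f f' g g' : ℝ → ℝ}
    (hf : ∀ x ∈ Icc (0:ℝ) π, HasDerivWithinAt f (f' x) (Icc 0 π) x)
    (hg : ∀ x ∈ Icc (0:ℝ) π, HasDerivWithinAt g (g' x) (Icc 0 π) x)
    (hf' : ContinuousOn f' (Icc 0 π)) (hg' : ContinuousOn g' (Icc 0 π))
    (f0 : f 0 = 0) (fπ : f π = 0) :
    ∫ x in (0:ℝ)..π, f x * g' x = - ∫ x in (0:ℝ)..π, f' x * g x := by
  have h : uIcc (0:ℝ) π = Icc 0 π := uIcc_of_le pi_pos.le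
  rw [intervalIntegral.integral_mul_deriv_eq_deriv_mul_of_hasDerivWithinAt
    (u := f) (u' := f') (v := g) (v' := g') (by rwa [h]) (by rwa [h]) (aux_ii hf') (aux_ii hg')]
  simp [f0, fπ]

lemma aux_sup {f f' : ℝ → ℝ}
    (hf : ∀ x ∈ Icc (0:ℝ) π, HasDerivWithinAt f (f' x) (Icc 0 π) x)
    (hf' : ContinuousOn f' (Icc 0 π))
    (f0 : f 0 = 0) (x : ℝ) (hx : x ∈ Icc (0:ℝ) π) :
    f x ^ 2 ≤ (∫ x in (0:ℝ)..π, f x ^ 2) + ∫ x in (0:ℝ)..π, f' x ^ 2 := by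
  have hfc : ContinuousOn f (Icc 0 π) := fun x hx => (hf x hx).continuousWithinAt
  have hsub : Icc 0 x ⊆ Icc 0 π := Icc_subset_Icc_right hx.2
  have h1 : ∫ y in (0:ℝ)..x, 2 * f y * f' y = f x ^ 2 - f 0 ^ 2 := by
    apply intervalIntegral.integral_eq_sub_of_hasDerivAt_of_le hx.1
    · exact (hfc.mono hsub).pow 2
    · intro y hy
      have := (hf y ⟨hy.1.le, hy.2.le.trans hx.2⟩).hasDerivAt
        (Icc_mem_nhds hy.1 (hy.2.trans_le hx.2))
      simpa using this.fun_pow 2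
    · apply ContinuousOn.intervalIntegrable_of_Icc hx.1
      exact ((continuousOn_const.mul hfc).mul hf').mono hsub
  have hc : ContinuousOn (fun y => f y ^ 2 + f' y ^ 2) (Icc 0 π) := (hfc.pow 2).add (hf'.pow 2)
  have h2 : ∫ y in (0:ℝ)..x, 2 * f y * f' y ≤ ∫ y in (0:ℝ)..x, f y ^ 2 + f' y ^ 2 := by
    apply intervalIntegral.integral_mono_on hx.1
    · apply ContinuousOn.intervalIntegrable_of_Icc hx.1
      exact ((continuousOn_const.mul hfc).mul hf').mono hsub
    · apply ContinuousOn.intervalIntegrable_of_Icc hx.1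
      exact hc.mono hsub
    · intro y _
      nlinarith [sq_nonneg (f y - f' y)]
  have h3 : ∫ y in (0:ℝ)..x, f y ^ 2 + f' y ^ 2 ≤ ∫ y in (0:ℝ)..π, f y ^ 2 + f' y ^ 2 := by
    apply intervalIntegral.integral_mono_interval le_rfl hx.1 hx.2
    · exact Filter.Eventually.of_forall fun y => by positivity
    · exact aux_ii hc
  have hp1 : IntervalIntegrable (fun y => f y ^ 2) volume 0 π := aux_ii (hfc.pow 2)
  have hp2 : IntervalIntegrable (fun y => f' y ^ 2) volume 0 π := aux_ii (hf'.pow 2)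
  rw [intervalIntegral.integral_add hp1 hp2] at h3
  rw [f0] at h1
  linarith

lemma aux_wirt {f f' : ℝ → ℝ}
    (hf : ∀ x ∈ Icc (0:ℝ) π, HasDerivWithinAt f (f' x) (Icc 0 π) x)
    (hf' : ContinuousOn f' (Icc 0 π))
    (f0 : f 0 = 0) (fπ : f π = 0) :
    ∫ x in (0:ℝ)..π, f x ^ 2 ≤ ∫ x in (0:ℝ)..π, f' x ^ 2 := by
  have hfc : ContinuousOn f (Icc 0 π) := fun x hx => (hf x hx).continuousWithinAt
  have key : ∀ l : ℝ, l ∈ Ioo (0:ℝ) 1 →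
      l ^ 2 * ∫ x in (0:ℝ)..π, f x ^ 2 ≤ ∫ x in (0:ℝ)..π, f' x ^ 2 := by
    intro l hl
    have hcos : ∀ x ∈ Icc (0:ℝ) π, 0 < cos (l * (x - π / 2)) := by
      intro x hx
      apply cos_pos_of_mem_Ioo
      have := pi_pos
      constructor <;> nlinarith [hx.1, hx.2, hl.1, hl.2]
    have htan : ∀ x ∈ Icc (0:ℝ) π, HasDerivWithinAt (fun x => tan (l * (x - π / 2)))
        (l * (1 + tan (l * (x - π / 2)) ^ 2)) (Icc 0 π) x := by
      intro x hx
      have h1 := hasDerivAt_tan (hcos x hx).ne'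
      have h2 : HasDerivAt (fun x : ℝ => l * (x - π / 2)) l x := by
        simpa using ((hasDerivAt_id x).sub_const (π / 2)).const_mul l
      have := (h1.comp x h2).hasDerivWithinAt (s := Icc 0 π)
      refine this.congr_deriv ?_
      rw [← inv_one_add_tan_sq (hcos x hx).ne'] <;> try simp
      ring
    have htc : ContinuousOn (fun x => tan (l * (x - π / 2))) (Icc 0 π) :=
      fun x hx => (htan x hx).continuousWithinAt
    have hp := aux_parts (f := fun x => f x ^ 2) (f' := fun x => 2 * f x * f' x)
      (fun x hx => by simpa using (hf x hx).fun_pow 2) htan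
      ((continuousOn_const.mul hfc).mul hf')
      (continuousOn_const.mul (continuousOn_const.add (htc.pow 2))) (by simp [f0]) (by simp [fπ])
    have hnn : 0 ≤ ∫ x in (0:ℝ)..π, (f' x + l * f x * tan (l * (x - π / 2))) ^ 2 :=
      intervalIntegral.integral_nonneg pi_pos.le fun x _ => sq_nonneg _
    have e1 : ∫ x in (0:ℝ)..π, (f' x + l * f x * tan (l * (x - π / 2))) ^ 2
      = (∫ x in (0:ℝ)..π, f' x ^ 2)
        + l * (∫ x in (0:ℝ)..π, 2 * f x * f' x * tan (l * (x - π / 2)))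
        + l * (∫ x in (0:ℝ)..π, f x ^ 2 * (l * (1 + tan (l * (x - π / 2)) ^ 2)))
        - l ^ 2 * ∫ x in (0:ℝ)..π, f x ^ 2 := by
      have := aux_lin ![1, l, l, -l ^ 2] ![fun x => f' x ^ 2,
        fun x => 2 * f x * f' x * tan (l * (x - π / 2)),
        fun x => f x ^ 2 * (l * (1 + tan (l * (x - π / 2)) ^ 2)), fun x => f x ^ 2] (by
          intro i; fin_cases i <;> simp <;> fun_prop)
      simp [Fin.sum_univ_succ, -intervalIntegral.integral_const_mul] at this
      trans
      · trans
        swap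
        · exact this
        · congr 1
          ext x
          ring
      · ring
    rw [hp] at e1
    linarith
  have ht : Tendsto (fun l : ℝ => l ^ 2 * ∫ x in (0:ℝ)..π, f x ^ 2) (nhdsWithin 1 (Iio 1))
      (nhds (1 ^ 2 * ∫ x in (0:ℝ)..π, f x ^ 2)) := by
    apply Tendsto.mono_left _ nhdsWithin_le_nhds
    exact (((continuous_id.pow 2).mul continuous_const).tendsto 1)
  have := le_of_tendsto ht (b := ∫ x in (0:ℝ)..π, f' x ^ 2) (by
    filter_upwards [Ioo_mem_nhdsLT (zero_lt_one' ℝ)] with l hl using key l hl)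
  simpa using this

lemma aux_leib (f f' : ℝ → ℝ → ℝ) (t0 x : ℝ) (hx : x ∈ Icc (0:ℝ) π)
    (hf : ContinuousOn (fun p : ℝ × ℝ => f p.1 p.2) (Icc 0 π ×ˢ Ici t0))
    (hf' : ContinuousOn (fun p : ℝ × ℝ => f' p.1 p.2) (Icc 0 π ×ˢ Ici t0))
    (hd : ∀ x ∈ Icc (0:ℝ) π, ∀ t ∈ Ici t0, HasDerivWithinAt (fun s => f x s) (f' x t) (Ici t0) t)
    (t : ℝ) (ht : t0 < t) :
    HasDerivAt (fun s => ∫ y in (0:ℝ)..x, f y s) (∫ y in (0:ℝ)..x, f' y t) t := by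
  have hsub : Icc 0 x ⊆ Icc 0 π := Icc_subset_Icc_right hx.2
  have hsl : ∀ (g : ℝ → ℝ → ℝ), ContinuousOn (fun p : ℝ × ℝ => g p.1 p.2) (Icc 0 π ×ˢ Ici t0) →
      ∀ s, t0 ≤ s → ContinuousOn (fun y => g y s) (Icc 0 x) := by
    intro g hg s hs
    exact hg.comp (f := fun y : ℝ => (y, s)) (by fun_prop) (fun y hy => ⟨hsub hy, hs⟩)
  have hu : uIoc 0 x ⊆ Icc 0 x := by
    rw [uIoc_of_le hx.1]; exact Ioc_subset_Icc_self
  have hK : IsCompact (Icc (0:ℝ) π ×ˢ Icc t0 (t+1)) := isCompact_Icc.prod isCompact_Icc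
  obtain ⟨B, hB⟩ := hK.exists_bound_of_continuousOn
    (hf'.mono (prod_mono le_rfl Icc_subset_Ici_self))
  refine (intervalIntegral.hasDerivAt_integral_of_dominated_loc_of_deriv_le
    (F := fun s y => f y s) (F' := fun s y => f' y s) (bound := fun _ => B)
    (s := Ioo t0 (t+1)) (Ioo_mem_nhds ht (by linarith)) ?_ ?_ ?_ ?_ ?_ ?_).2
  · filter_upwards [Ioi_mem_nhds ht] with s hs
    exact ((hsl f hf s (le_of_lt hs)).mono hu).aestronglyMeasurable measurableSet_uIoc
  · exact ContinuousOn.intervalIntegrable_of_Icc hx.1 (hsl f hf t ht.le)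
  · exact ((hsl f' hf' t ht.le).mono hu).aestronglyMeasurable measurableSet_uIoc
  · refine Eventually.of_forall fun y hy s hs => hB (y, s) ⟨hsub (hu hy), hs.1.le, hs.2.le⟩
  · simp
  · refine Eventually.of_forall fun y hy s hs => ?_
    exact (hd y (hsub (hu hy)) s hs.1.le).hasDerivAt (Ici_mem_nhds hs.1)

lemma aux_contint (f : ℝ → ℝ → ℝ) (t0 : ℝ)
    (hf : ContinuousOn (fun p : ℝ × ℝ => f p.1 p.2) (Icc 0 π ×ˢ Ici t0)) :
    ContinuousOn (fun s => ∫ y in (0:ℝ)..π, f y s) (Ici t0) := by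
  have h1 : Continuous (Function.uncurry fun (s y : ℝ) => f (max 0 (min y π)) (max s t0)) := by
    have : Continuous fun q : ℝ × ℝ => (max 0 (min q.2 π), max q.1 t0) := by fun_prop
    exact hf.comp_continuous this (fun q => ⟨⟨le_max_left _ _, max_le pi_pos.le (min_le_right _ _)⟩,
      show t0 ≤ max q.1 t0 from le_max_right _ _⟩)
  have h2 := intervalIntegral.continuous_parametric_intervalIntegral_of_continuous' (μ := volume)
    h1 0 π
  refine h2.continuousOn.congr fun s hs => ?_
  apply intervalIntegral.integral_congr
  intro y hy
  rw [uIcc_of_le pi_pos.le] at hy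
  have hs' : t0 ≤ s := hs
  simp [hy.1, hy.2, hs']

lemma aux_ode (d V : ℝ → ℝ) (t0 r c c2 c3 : ℝ) (hr : 0 < r) (hc : 0 < c) (hc2 : 0 < c2)
    (hc3 : 0 < c3) (hd0 : ∀ t, 0 ≤ d t)
    (hdc : ContinuousOn d (Ici t0)) (hVc : ContinuousOn V (Ici t0))
    (hV : ∀ t, t0 ≤ t → d t ≤ r → c3 * d t ^ 2 ≤ V t ∧ V t ≤ c2 * d t ^ 2)
    (hV' : ∀ t, t0 < t → d t ≤ r → ∃ v, HasDerivAt V v t ∧ v ≤ - c * d t ^ 2)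
    (hinit : d t0 < r * min 1 (√(c3 / c2))) (t : ℝ) (ht : t0 ≤ t) :
    d t ≤ √(c2 / c3) * exp (-(c / (2 * c2)) * (t - t0)) * d t0 := by
  have hinit1 : d t0 < r := hinit.trans_le (by nlinarith [min_le_left 1 (√(c3 / c2))])
  have hinit2 : c2 * d t0 ^ 2 < c3 * r ^ 2 := by
    have h1 : d t0 < r * √(c3 / c2) := hinit.trans_le (by nlinarith [min_le_right 1 (√(c3 / c2))])
    have h2 : d t0 ^ 2 < (r * √(c3 / c2)) ^ 2 := by
      have := hd0 t0
      gcongr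
    rw [mul_pow, sq_sqrt (by positivity)] at h2
    calc c2 * d t0 ^ 2 < c2 * (r ^ 2 * (c3 / c2)) := by gcongr
      _ = c3 * r ^ 2 := by field_simp
  -- antitone lemma
  have anti : ∀ t1, t0 ≤ t1 → (∀ s ∈ Ico t0 t1, d s ≤ r) →
      AntitoneOn (fun s => V s * exp (c / c2 * s)) (Icc t0 t1) := by
    intro t1 _ hs
    have hex : ∀ s ∈ Ioo t0 t1, ∃ v, HasDerivAt V v s ∧ v ≤ - c * d s ^ 2 := fun s h =>
      hV' s h.1 (hs s ⟨h.1.le, h.2⟩)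
    choose! v hv using hex
    apply antitoneOn_of_hasDerivWithinAt_nonpos (convex_Icc t0 t1)
      (f' := fun s => v s * exp (c / c2 * s) + V s * (exp (c / c2 * s) * (c / c2)))
    · exact (hVc.mono Icc_subset_Ici_self).mul (by fun_prop)
    · intro s h
      rw [interior_Icc] at h
      have h2 : HasDerivAt (fun s : ℝ => c / c2 * s) (c / c2) s := by
        simpa using (hasDerivAt_id s).const_mul (c / c2)
      exact ((hv s h).1.mul h2.exp).hasDerivWithinAt
    · intro s h
      rw [interior_Icc] at h
      have h1 := (hv s h).2
      have h2 := (hV s h.1.le (hs s ⟨h.1.le, h.2⟩)).2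
      have h3 : c / c2 * V s ≤ c * d s ^ 2 := by
        calc c / c2 * V s ≤ c / c2 * (c2 * d s ^ 2) := by gcongr
          _ = _ := by field_simp
      have : v s * exp (c / c2 * s) + V s * (exp (c / c2 * s) * (c / c2))
        = exp (c / c2 * s) * (v s + c / c2 * V s) := by ring
      rw [this]
      apply mul_nonpos_of_nonneg_of_nonpos (exp_pos _).le
      linarith
  have main : ∀ t1, t0 ≤ t1 → (∀ s ∈ Ico t0 t1, d s ≤ r) →
      V t1 ≤ exp (-(c / c2) * (t1 - t0)) * V t0 := by
    intro t1 h1 hs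
    have := anti t1 h1 hs ⟨le_rfl, h1⟩ ⟨h1, le_rfl⟩ h1
    simp only at this
    have e : exp (-(c / c2) * (t1 - t0)) = exp (c / c2 * t0) / exp (c / c2 * t1) := by
      rw [← exp_sub]; ring_nf
    rw [e, div_mul_eq_mul_div, le_div_iff₀ (exp_pos _)]
    linarith
  have small : ∀ t1, t0 ≤ t1 → d t1 < r := by
    by_contra! hcon
    obtain ⟨t2, ht2, hd2⟩ := hcon
    set B := {s | s ∈ Icc t0 t2 ∧ r ≤ d s} with hB
    have hBc : IsClosed B := by
      have : B = Icc t0 t2 ∩ d ⁻¹' (Ici r) := by ext; simp [hB]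
      rw [this]
      exact (hdc.mono Icc_subset_Ici_self).preimage_isClosed_of_isClosed isClosed_Icc isClosed_Ici
    have hBn : B.Nonempty := ⟨t2, ⟨ht2, le_rfl⟩, hd2⟩
    have hBb : BddBelow B := ⟨t0, fun s hs => hs.1.1⟩
    have hm := hBc.csInf_mem hBn hBb
    set t1 := sInf B
    have hlt : ∀ s ∈ Ico t0 t1, d s < r := by
      intro s hs
      by_contra! h
      exact absurd (csInf_le hBb (show s ∈ B from ⟨⟨hs.1, hs.2.le.trans hm.1.2⟩, h⟩)) (not_le.2 hs.2)
    have ht01 : t0 < t1 := by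
      rcases hm.1.1.lt_or_eq with h | h
      · exact h
      · have := hm.2
        rw [← h] at this
        linarith
    have hle : d t1 ≤ r := by
      have hcw : ContinuousWithinAt d (Ico t0 t1) t1 :=
        (hdc t1 ht01.le).mono (fun s hs => hs.1)
      have : (nhdsWithin t1 (Ico t0 t1)).NeBot := by
        rw [← mem_closure_iff_nhdsWithin_neBot, closure_Ico ht01.ne]
        exact ⟨ht01.le, le_rfl⟩
      refine le_of_tendsto hcw ?_
      filter_upwards [self_mem_nhdsWithin] with s hs using (hlt s hs).le
    have h1 := main t1 ht01.le (fun s hs => (hlt s hs).le)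
    have h2 := (hV t1 ht01.le hle).1
    have h3 := hV t0 le_rfl hinit1.le
    have h4 : exp (-(c / c2) * (t1 - t0)) ≤ 1 := by
      rw [exp_le_one_iff]
      have : 0 < c / c2 := by positivity
      nlinarith
    have h0 : 0 ≤ V t0 := le_trans (by positivity) h3.1
    have h5 : V t1 ≤ V t0 := h1.trans (by nlinarith)
    have h6 : d t1 = r := le_antisymm hle hm.2
    rw [h6] at h2
    linarith
  have h1 := main t ht (fun s hs => (small s hs.1).le)
  have h2 := (hV t ht (small t ht).le).1
  have h3 := (hV t0 le_rfl hinit1.le).2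
  have h4 : d t ^ 2 ≤ (√(c2 / c3) * exp (-(c / (2 * c2)) * (t - t0)) * d t0) ^ 2 := by
    rw [mul_pow, mul_pow, sq_sqrt (by positivity), ← exp_nat_mul]
    have e : ((2:ℕ):ℝ) * (-(c / (2 * c2)) * (t - t0)) = -(c / c2) * (t - t0) := by
      push_cast; field_simp
    rw [e]
    have : c3 * d t ^ 2 ≤ exp (-(c / c2) * (t - t0)) * (c2 * d t0 ^ 2) := by
      refine h2.trans (h1.trans ?_)
      gcongr
    have e2 : c2 / c3 * exp (-(c / c2) * (t - t0)) * d t0 ^ 2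
      = exp (-(c / c2) * (t - t0)) * (c2 * d t0 ^ 2) / c3 := by ring
    rw [e2, le_div_iff₀ hc3]
    linarith
  exact (pow_le_pow_iff_left₀ (hd0 t) (by have := hd0 t0; positivity) two_ne_zero).1 h4

lemma aux_zF (F F' : ℝ → ℝ) (k ρ : ℝ) (hFderiv : ∀ z, HasDerivAt F (F' z) z) (hF0 : F 0 = 0)
    (hFk : ∀ z, |z| < ρ → F' z ≤ k) (z : ℝ) (hz : |z| < ρ) :
    (0 ≤ z → F z ≤ k * z) ∧ (z ≤ 0 → k * z ≤ F z) := by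
  have hmono : MonotoneOn (fun z => k * z - F z) (Ioo (-ρ) ρ) := by
    apply monotoneOn_of_hasDerivWithinAt_nonneg (convex_Ioo _ _) (f' := fun z => k - F' z)
    · intro z _
      exact (((hasDerivAt_id z).const_mul k).sub (hFderiv z)).continuousAt.continuousWithinAt
    · intro z _
      simpa using (((hasDerivAt_id z).const_mul k).fun_sub (hFderiv z)).hasDerivWithinAt
    · intro z hz
      rw [interior_Ioo] at hz
      have := hFk z (abs_lt.2 hz)
      linarith
  have hz' := abs_lt.1 hz
  have h0 : (0:ℝ) ∈ Ioo (-ρ) ρ := by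
    have := (abs_nonneg z).trans_lt hz
    constructor <;> linarith
  constructor
  · intro h
    have := hmono h0 hz' h
    simp [hF0] at this
    linarith
  · intro h
    have := hmono hz' h0 h
    simp [hF0] at this
    linarith

lemma aux_zF2 (F F' : ℝ → ℝ) (k ρ : ℝ) (hFderiv : ∀ z, HasDerivAt F (F' z) z) (hF0 : F 0 = 0)
    (hFk : ∀ z, |z| < ρ → F' z ≤ k) (z : ℝ) (hz : |z| < ρ) :
    z * F z ≤ k * z ^ 2 := by
  have := aux_zF F F' k ρ hFderiv hF0 hFk z hz
  rcases le_total 0 z with h | h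
  · nlinarith [this.1 h]
  · nlinarith [this.2 h]

lemma aux_Phi (F F' : ℝ → ℝ) (k ρ : ℝ) (hFderiv : ∀ z, HasDerivAt F (F' z) z) (hF0 : F 0 = 0)
    (hFk : ∀ z, |z| < ρ → F' z ≤ k) (z : ℝ) (hz : |z| < ρ) :
    ∫ s in (0:ℝ)..z, F s ≤ k / 2 * z ^ 2 := by
  have hc : Continuous F := continuous_iff_continuousAt.2 fun z => (hFderiv z).continuousAt
  have key : ∫ s in (0:ℝ)..z, k * s = k / 2 * z ^ 2 := by
    rw [intervalIntegral.integral_const_mul, integral_id]; ring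
  rw [← key]
  rcases le_total 0 z with h | h
  · apply intervalIntegral.integral_mono_on h (hc.intervalIntegrable _ _)
      (Continuous.intervalIntegrable (by fun_prop) _ _)
    intro s hs
    refine (aux_zF F F' k ρ hFderiv hF0 hFk s ?_).1 hs.1
    rw [abs_of_nonneg hs.1]
    exact hs.2.trans_lt ((le_abs_self z).trans_lt hz)
  · rw [intervalIntegral.integral_symm, intervalIntegral.integral_symm z, neg_le_neg_iff]
    apply intervalIntegral.integral_mono_on h (Continuous.intervalIntegrable (by fun_prop) _ _)
      (hc.intervalIntegrable _ _)
    intro s hs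
    refine (aux_zF F F' k ρ hFderiv hF0 hFk s ?_).2 hs.2
    rw [abs_of_nonpos hs.2]
    have := neg_abs_le z
    linarith [hs.1]

lemma aux_slice {g : ℝ → ℝ → ℝ} {t0 : ℝ}
    (hg : ContinuousOn (fun p : ℝ × ℝ => g p.1 p.2) (Icc 0 π ×ˢ Ici t0)) {s : ℝ} (hs : t0 ≤ s) :
    ContinuousOn (fun y => g y s) (Icc 0 π) :=
  hg.comp (f := fun y : ℝ => (y, s)) (by fun_prop) (fun _ hy => ⟨hy, hs⟩)

lemma aux_ut (u ux uxx ut uxxt : ℝ → ℝ → ℝ) (t0 : ℝ)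
    (hux : ∀ t ∈ Ici t0, ∀ x ∈ Icc (0:ℝ) π,
      HasDerivWithinAt (fun y => u y t) (ux x t) (Icc 0 π) x)
    (huxx : ∀ t ∈ Ici t0, ∀ x ∈ Icc (0:ℝ) π,
      HasDerivWithinAt (fun y => ux y t) (uxx x t) (Icc 0 π) x)
    (hut : ∀ x ∈ Icc (0:ℝ) π, ∀ t ∈ Ici t0,
      HasDerivWithinAt (fun s => u x s) (ut x t) (Ici t0) t)
    (huxxt : ∀ x ∈ Icc (0:ℝ) π, ∀ t ∈ Ici t0,
      HasDerivWithinAt (fun s => uxx x s) (uxxt x t) (Ici t0) t)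
    (cont_uxx : ContinuousOn (fun p : ℝ × ℝ => uxx p.1 p.2) (Icc 0 π ×ˢ Ici t0))
    (cont_uxxt : ContinuousOn (fun p : ℝ × ℝ => uxxt p.1 p.2) (Icc 0 π ×ˢ Ici t0))
    (bc0 : ∀ t ∈ Ici t0, u 0 t = 0)
    (bcπ : ∀ t ∈ Ici t0, u π t = 0) (t : ℝ) (ht : t0 < t) :
    ut 0 t = 0 ∧ ut π t = 0 ∧ ∃ w : ℝ → ℝ,
      (∀ x ∈ Icc (0:ℝ) π, HasDerivWithinAt (fun y => ut y t) (w x) (Icc 0 π) x) ∧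
      (∀ x ∈ Icc (0:ℝ) π, HasDerivWithinAt w (uxxt x t) (Icc 0 π) x) := by
  have h0m : (0:ℝ) ∈ Icc (0:ℝ) π := ⟨le_rfl, pi_pos.le⟩
  have hπm : π ∈ Icc (0:ℝ) π := ⟨pi_pos.le, le_rfl⟩
  have hbc : ∀ x ∈ Icc (0:ℝ) π, (∀ s ∈ Ici t0, u x s = 0) → ut x t = 0 := by
    intro x hx h
    have h1 := (hut x hx t ht.le).hasDerivAt (Ici_mem_nhds ht)
    have h2 : HasDerivAt (fun s => u x s) 0 t := by
      apply (hasDerivAt_const t (0:ℝ)).congr_of_eventuallyEq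
      filter_upwards [Ici_mem_nhds ht] with s hs using h s hs
    exact h1.unique h2
  refine ⟨hbc 0 h0m bc0, hbc π hπm bcπ, ?_⟩
  have form : ∀ s ∈ Ici t0, ∀ x ∈ Icc (0:ℝ) π,
      ∫ y in (0:ℝ)..x, (x - y) * uxx y s = u x s - x * ux 0 s := by
    intro s hs x hx
    have hsub : Icc 0 x ⊆ Icc 0 π := Icc_subset_Icc_right hx.2
    have := intervalIntegral.integral_eq_sub_of_hasDerivAt_of_le (a := 0) (b := x)
      (f := fun y => (x - y) * ux y s + u y s) (f' := fun y => (x - y) * uxx y s) hx.1 ?_ ?_ ?_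
    · rw [this]
      simp [bc0 s hs]
    · intro y hy
      refine ContinuousWithinAt.mono ?_ hsub
      exact (ContinuousWithinAt.mul (by fun_prop) (huxx s hs y (hsub hy)).continuousWithinAt).add
        (hux s hs y (hsub hy)).continuousWithinAt
    · intro y hy
      have hn : Icc 0 π ∈ nhds y := Icc_mem_nhds hy.1 (hy.2.trans_le hx.2)
      have hy' : y ∈ Icc 0 π := ⟨hy.1.le, hy.2.le.trans hx.2⟩
      have h1 := (huxx s hs y hy').hasDerivAt hn
      have h2 := (hux s hs y hy').hasDerivAt hn
      have := (((hasDerivAt_id y).const_sub x).mul h1).add h2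
      refine this.congr_deriv ?_
      simp
    · apply ContinuousOn.intervalIntegrable_of_Icc hx.1
      exact ContinuousOn.mul (by fun_prop) ((aux_slice cont_uxx hs).mono hsub)
  have lb : ∀ x ∈ Icc (0:ℝ) π, HasDerivAt (fun s => ∫ y in (0:ℝ)..x, (x - y) * uxx y s)
      (∫ y in (0:ℝ)..x, (x - y) * uxxt y t) t := by
    intro x hx
    apply aux_leib (fun y s => (x - y) * uxx y s) (fun y s => (x - y) * uxxt y s) t0 x hx _ _ _ t ht
    · exact ContinuousOn.mul (by fun_prop) cont_uxx
    · exact ContinuousOn.mul (by fun_prop) cont_uxxt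
    · intro y hy s hs
      exact (huxxt y hy s hs).const_mul _
  set B := -(∫ y in (0:ℝ)..π, (π - y) * uxxt y t) / π with hB
  have hb : HasDerivAt (fun s => ux 0 s) B t := by
    have := (lb π hπm).neg.div_const π
    refine this.congr_of_eventuallyEq ?_
    filter_upwards [Ici_mem_nhds ht] with s hs
    have h := form s hs π hπm
    rw [bcπ s hs] at h
    simp only [Pi.neg_apply, h]
    field_simp
    ring
  have uform : ∀ x ∈ Icc (0:ℝ) π, ut x t = x * B + ∫ y in (0:ℝ)..x, (x - y) * uxxt y t := by
    intro x hx
    have h1 := (hut x hx t ht.le).hasDerivAt (Ici_mem_nhds ht)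
    have h2 : HasDerivAt (fun s => u x s) (x * B + ∫ y in (0:ℝ)..x, (x - y) * uxxt y t) t := by
      apply ((hb.const_mul x).add (lb x hx)).congr_of_eventuallyEq
      filter_upwards [Ici_mem_nhds ht] with s hs
      simp [form s hs x hx]
    exact h1.unique h2
  set g : ℝ → ℝ := fun y => uxxt (max 0 (min y π)) t with hg
  have hgc : Continuous g := by
    have : Continuous fun q : ℝ => max 0 (min q π) := by fun_prop
    exact (aux_slice cont_uxxt ht.le).comp_continuous this
      (fun q => ⟨le_max_left _ _, max_le pi_pos.le (min_le_right _ _)⟩)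
  have hgeq : ∀ y ∈ Icc (0:ℝ) π, g y = uxxt y t := by
    intro y hy
    simp [hg, hy.1, hy.2]
  have uform2 : ∀ x ∈ Icc (0:ℝ) π, ut x t =
      x * B + (x * (∫ y in (0:ℝ)..x, g y) - ∫ y in (0:ℝ)..x, y * g y) := by
    intro x hx
    rw [uform x hx, ← intervalIntegral.integral_const_mul, ← intervalIntegral.integral_sub]
    · congr 1
      apply intervalIntegral.integral_congr
      intro y hy
      rw [uIcc_of_le hx.1] at hy
      simp only [hgeq y ⟨hy.1, hy.2.trans hx.2⟩]
      ring
    · exact Continuous.intervalIntegrable (by fun_prop) _ _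
    · exact Continuous.intervalIntegrable (by fun_prop) _ _
  refine ⟨fun x => B + ∫ y in (0:ℝ)..x, g y, ?_, ?_⟩
  · intro x hx
    have h1 := (hgc.integral_hasStrictDerivAt 0 x).hasDerivAt
    have h2 := ((show Continuous fun y => y * g y by fun_prop).integral_hasStrictDerivAt 0 x).hasDerivAt
    have h3 := (((hasDerivAt_id x).mul_const B).add
      (((hasDerivAt_id x).mul h1).sub h2)).hasDerivWithinAt (s := Icc 0 π)
    refine (h3.congr_deriv ?_).congr_of_mem (fun y hy => ?_) hx
    · simp
    · simpa using uform2 y hy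
  · intro x hx
    have h1 := (hgc.integral_hasStrictDerivAt 0 x).hasDerivAt
    rw [hgeq x hx] at h1
    exact (h1.const_add B).hasDerivWithinAt

lemma aux_est (u ux uxx ut w uxxt utt aa F F' : ℝ → ℝ) (e Ct a' A k μ s : ℝ)
    (hux : ∀ x ∈ Icc (0:ℝ) π, HasDerivWithinAt u (ux x) (Icc 0 π) x)
    (huxx : ∀ x ∈ Icc (0:ℝ) π, HasDerivWithinAt ux (uxx x) (Icc 0 π) x)
    (hw : ∀ x ∈ Icc (0:ℝ) π, HasDerivWithinAt ut (w x) (Icc 0 π) x)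
    (hwx : ∀ x ∈ Icc (0:ℝ) π, HasDerivWithinAt w (uxxt x) (Icc 0 π) x)
    (c_uxx : ContinuousOn uxx (Icc 0 π)) (c_uxxt : ContinuousOn uxxt (Icc 0 π))
    (c_utt : ContinuousOn utt (Icc 0 π)) (c_aa : ContinuousOn aa (Icc 0 π))
    (hFd : ∀ z, HasDerivAt F (F' z) z) (hF'c : Continuous F') (hF0 : F 0 = 0)
    (u0 : u 0 = 0) (uπ : u π = 0) (ut0 : ut 0 = 0) (utπ : ut π = 0)
    (he : 0 ≤ e) (ha' : 0 ≤ a') (hμ : 0 < μ) (hs : 0 < s)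
    (haa : ∀ x ∈ Icc (0:ℝ) π, 0 ≤ aa x ∧ aa x ≤ A)
    (hFk : ∀ x ∈ Icc (0:ℝ) π, F' (u x) ≤ k) (hzF : ∀ x ∈ Icc (0:ℝ) π, u x * F (u x) ≤ k * u x ^ 2)
    (pde : ∀ x ∈ Ioo (0:ℝ) π, -e * uxxt x + utt x - Ct * uxx x + a' * ut x
      = F (u x) - aa x * ut x) :
    (∫ x in (0:ℝ)..π, u x * uxxt x = ∫ x in (0:ℝ)..π, uxx x * ut x) ∧
    (e ^ 2 * (∫ x in (0:ℝ)..π, uxx x * uxxt x) - e * (∫ x in (0:ℝ)..π, uxx x * utt x)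
      - e * (∫ x in (0:ℝ)..π, ut x * uxxt x) + (∫ x in (0:ℝ)..π, ut x * utt x)
      ≤ - Ct * e * (∫ x in (0:ℝ)..π, uxx x ^ 2) + μ / 2 * e ^ 2 * (∫ x in (0:ℝ)..π, uxx x ^ 2)
        + (a' + A) ^ 2 / (2 * μ) * (∫ x in (0:ℝ)..π, ut x ^ 2)
        + Ct * (∫ x in (0:ℝ)..π, uxx x * ut x) + e * k * (∫ x in (0:ℝ)..π, ux x ^ 2)
        + ∫ x in (0:ℝ)..π, F (u x) * ut x) ∧
    ((∫ x in (0:ℝ)..π, ut x * utt x) ≤ - e * (∫ x in (0:ℝ)..π, ut x ^ 2)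
      + Ct * (∫ x in (0:ℝ)..π, uxx x * ut x) - a' * (∫ x in (0:ℝ)..π, ut x ^ 2)
      - (∫ x in (0:ℝ)..π, aa x * ut x ^ 2) + ∫ x in (0:ℝ)..π, F (u x) * ut x) ∧
    ((∫ x in (0:ℝ)..π, u x * utt x) ≤ e * (∫ x in (0:ℝ)..π, uxx x * ut x)
      - Ct * (∫ x in (0:ℝ)..π, ux x ^ 2) - a' * (∫ x in (0:ℝ)..π, u x * ut x)
      + s * A * (∫ x in (0:ℝ)..π, u x ^ 2) + 1 / (4 * s) * (∫ x in (0:ℝ)..π, aa x * ut x ^ 2)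
      + k * (∫ x in (0:ℝ)..π, u x ^ 2)) ∧
    0 ≤ ∫ x in (0:ℝ)..π, aa x * ut x ^ 2 := by
  have c_u : ContinuousOn u (Icc 0 π) := fun x hx => (hux x hx).continuousWithinAt
  have c_ux : ContinuousOn ux (Icc 0 π) := fun x hx => (huxx x hx).continuousWithinAt
  have c_ut : ContinuousOn ut (Icc 0 π) := fun x hx => (hw x hx).continuousWithinAt
  have c_w : ContinuousOn w (Icc 0 π) := fun x hx => (hwx x hx).continuousWithinAt
  have cF : Continuous F := continuous_iff_continuousAt.2 fun z => (hFd z).continuousAt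
  have c_Fu : ContinuousOn (fun x => F (u x)) (Icc 0 π) := cF.comp_continuousOn c_u
  have c_F'u : ContinuousOn (fun x => F' (u x)) (Icc 0 π) := hF'c.comp_continuousOn c_u
  have J1 := aux_parts hux hwx c_ux c_uxxt u0 uπ
  have J2 := aux_parts hw huxx c_w c_uxx ut0 utπ
  have J3 := aux_parts hux huxx c_ux c_uxx u0 uπ
  have J4 := aux_parts hw hwx c_w c_uxxt ut0 utπ
  have J5 := aux_parts (f := fun x => F (u x)) (f' := fun x => F' (u x) * ux x)
    (fun x hx => (hFd (u x)).comp_hasDerivWithinAt x (hux x hx)) huxx (c_F'u.mul c_ux) c_uxx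
    (by simp [u0, hF0]) (by simp [uπ, hF0])
  have W := aux_wirt hw c_w ut0 utπ
  have K5 : ∫ x in (0:ℝ)..π, F' (u x) * ux x * ux x ≤ k * ∫ x in (0:ℝ)..π, ux x ^ 2 := by
    rw [← intervalIntegral.integral_const_mul]
    apply intervalIntegral.integral_mono_on pi_pos.le (aux_ii (by fun_prop)) (aux_ii (by fun_prop))
    intro x hx
    nlinarith [hFk x hx, sq_nonneg (ux x)]
  have E1 : ∫ x in (0:ℝ)..π, w x * w x = ∫ x in (0:ℝ)..π, w x ^ 2 := by
    congr 1; ext x; ring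
  have E2 : ∫ x in (0:ℝ)..π, ux x * ux x = ∫ x in (0:ℝ)..π, ux x ^ 2 := by
    congr 1; ext x; ring
  have E3 : ∫ x in (0:ℝ)..π, w x * ux x = ∫ x in (0:ℝ)..π, ux x * w x := by
    congr 1; ext x; ring
  have E4 : ∫ x in (0:ℝ)..π, ut x * uxx x = ∫ x in (0:ℝ)..π, uxx x * ut x := by
    congr 1; ext x; ring
  have J12 : ∫ x in (0:ℝ)..π, u x * uxxt x = ∫ x in (0:ℝ)..π, uxx x * ut x := by
    rw [J1, ← E4, J2, E3]
  refine ⟨J12, ?_, ?_, ?_, ?_⟩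
  · have h1 := aux_lin' (fun x => (e * uxx x - ut x) * (e * uxxt x - utt x))
      ![e ^ 2, -e, -e, 1] ![fun x => uxx x * uxxt x, fun x => uxx x * utt x,
        fun x => ut x * uxxt x, fun x => ut x * utt x]
      (by intro i; fin_cases i <;> simp <;> fun_prop)
      (by intro x; simp [Fin.sum_univ_succ]; ring)
    have h2 := aux_lin' (fun x => - Ct * e * uxx x ^ 2 + μ / 2 * e ^ 2 * uxx x ^ 2
        + (a' + A) ^ 2 / (2 * μ) * ut x ^ 2 + Ct * (uxx x * ut x) - e * (F (u x) * uxx x)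
        + F (u x) * ut x)
      ![- Ct * e + μ / 2 * e ^ 2, (a' + A) ^ 2 / (2 * μ), Ct, -e, 1]
      ![fun x => uxx x ^ 2, fun x => ut x ^ 2, fun x => uxx x * ut x, fun x => F (u x) * uxx x,
        fun x => F (u x) * ut x]
      (by intro i; fin_cases i <;> simp <;> fun_prop)
      (by intro x; simp [Fin.sum_univ_succ]; ring)
    have h3 : ∫ x in (0:ℝ)..π, (e * uxx x - ut x) * (e * uxxt x - utt x) ≤
      ∫ x in (0:ℝ)..π, - Ct * e * uxx x ^ 2 + μ / 2 * e ^ 2 * uxx x ^ 2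
        + (a' + A) ^ 2 / (2 * μ) * ut x ^ 2 + Ct * (uxx x * ut x) - e * (F (u x) * uxx x)
        + F (u x) * ut x := by
      apply intervalIntegral.integral_mono_on_of_le_Ioo pi_pos.le (aux_ii (by fun_prop))
        (aux_ii (by fun_prop))
      intro x hx
      have hx' := haa x ⟨hx.1.le, hx.2.le⟩
      have hp := pde x hx
      have e1 : e * uxxt x - utt x = - Ct * uxx x + (a' + aa x) * ut x - F (u x) := by linarith
      rw [e1]
      have k1 : (a' + aa x) * (e * uxx x) * ut x ≤
          μ / 2 * e ^ 2 * uxx x ^ 2 + (a' + A) ^ 2 / (2 * μ) * ut x ^ 2 := by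
        have k2 : (a' + aa x) ^ 2 ≤ (a' + A) ^ 2 := by
          have := hx'.1
          have := hx'.2
          gcongr
        have k3 : (a' + aa x) ^ 2 / (2 * μ) * ut x ^ 2 ≤ (a' + A) ^ 2 / (2 * μ) * ut x ^ 2 := by
          gcongr
        have k4 : 0 ≤ (μ * (e * uxx x) - (a' + aa x) * ut x) ^ 2 / (2 * μ) := by positivity
        have k5 : (μ * (e * uxx x) - (a' + aa x) * ut x) ^ 2 / (2 * μ) =
          μ / 2 * e ^ 2 * uxx x ^ 2 - (a' + aa x) * (e * uxx x) * ut x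
            + (a' + aa x) ^ 2 / (2 * μ) * ut x ^ 2 := by
          field_simp
          ring
        linarith
      have k6 : 0 ≤ (a' + aa x) * ut x ^ 2 := by
        have := hx'.1
        positivity
      linarith
    beta_reduce at h1 h2
    rw [h1, h2] at h3
    simp [Fin.sum_univ_succ, -intervalIntegral.integral_const_mul] at h3
    rw [J5] at h3
    have : e * (∫ x in (0:ℝ)..π, F' (u x) * ux x * ux x) ≤ e * (k * ∫ x in (0:ℝ)..π, ux x ^ 2) := by
      gcongr
    linarith
  · have h2 := aux_lin' (fun x => e * (ut x * uxxt x) + Ct * (uxx x * ut x) - a' * ut x ^ 2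
        - aa x * ut x ^ 2 + F (u x) * ut x)
      ![e, Ct, -a', -1, 1]
      ![fun x => ut x * uxxt x, fun x => uxx x * ut x, fun x => ut x ^ 2, fun x => aa x * ut x ^ 2,
        fun x => F (u x) * ut x]
      (by intro i; fin_cases i <;> simp <;> fun_prop)
      (by intro x; simp [Fin.sum_univ_succ]; ring)
    have h3 : ∫ x in (0:ℝ)..π, ut x * utt x ≤
      ∫ x in (0:ℝ)..π, e * (ut x * uxxt x) + Ct * (uxx x * ut x) - a' * ut x ^ 2
        - aa x * ut x ^ 2 + F (u x) * ut x := by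
      apply intervalIntegral.integral_mono_on_of_le_Ioo pi_pos.le (aux_ii (by fun_prop))
        (aux_ii (by fun_prop))
      intro x hx
      have hp := pde x hx
      have e1 : utt x = e * uxxt x + Ct * uxx x - (a' + aa x) * ut x + F (u x) := by linarith
      rw [e1]
      linarith
    beta_reduce at h2
    rw [h2] at h3
    simp [Fin.sum_univ_succ, -intervalIntegral.integral_const_mul] at h3
    rw [J4, E1] at h3
    nlinarith
  · have h2 := aux_lin' (fun x => e * (u x * uxxt x) + Ct * (u x * uxx x) - a' * (u x * ut x)
        + s * A * u x ^ 2 + 1 / (4 * s) * (aa x * ut x ^ 2) + k * u x ^ 2)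
      ![e, Ct, -a', s * A + k, 1 / (4 * s)]
      ![fun x => u x * uxxt x, fun x => u x * uxx x, fun x => u x * ut x, fun x => u x ^ 2,
        fun x => aa x * ut x ^ 2]
      (by intro i; fin_cases i <;> simp <;> fun_prop)
      (by intro x; simp [Fin.sum_univ_succ]; ring)
    have h3 : ∫ x in (0:ℝ)..π, u x * utt x ≤
      ∫ x in (0:ℝ)..π, e * (u x * uxxt x) + Ct * (u x * uxx x) - a' * (u x * ut x)
        + s * A * u x ^ 2 + 1 / (4 * s) * (aa x * ut x ^ 2) + k * u x ^ 2 := by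
      apply intervalIntegral.integral_mono_on_of_le_Ioo pi_pos.le (aux_ii (by fun_prop))
        (aux_ii (by fun_prop))
      intro x hx
      have hx1 : x ∈ Icc 0 π := ⟨hx.1.le, hx.2.le⟩
      have hx' := haa x hx1
      have hp := pde x hx
      have hz := hzF x hx1
      have e1 : utt x = e * uxxt x + Ct * uxx x - (a' + aa x) * ut x + F (u x) := by linarith
      rw [e1]
      have k1 : - (aa x * u x * ut x) ≤ s * A * u x ^ 2 + 1 / (4 * s) * (aa x * ut x ^ 2) := by
        have k4 : 0 ≤ aa x * (2 * s * u x + ut x) ^ 2 / (4 * s) := by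
          have := hx'.1
          positivity
        have k5 : aa x * (2 * s * u x + ut x) ^ 2 / (4 * s) =
          s * aa x * u x ^ 2 + aa x * u x * ut x + 1 / (4 * s) * (aa x * ut x ^ 2) := by
          field_simp
          ring
        have k6 : s * aa x * u x ^ 2 ≤ s * A * u x ^ 2 := by
          have := hx'.2
          gcongr
        linarith
      linarith
    beta_reduce at h2
    rw [h2] at h3
    simp [Fin.sum_univ_succ, -intervalIntegral.integral_const_mul] at h3
    rw [J12, J3, E2] at h3
    simp only [one_div, mul_inv]
    linarith
  · apply intervalIntegral.integral_nonneg pi_pos.le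
    intro x hx
    have := (haa x hx).1
    positivity

set_option maxHeartbeats 2000000 in
lemma arith1 (e e1 e2 Ct C1 a' A k μ s θ γ m c1 b K1 eM η ebar Cbar cc
    Zz R T X U Q Pa i1 j4 j5 j6 j7 j8 : ℝ)
    (hA : e ^ 2 * i1 - e * j5 - e * j4 + j6 ≤ - Ct * e * Zz + μ / 2 * e ^ 2 * Zz + K1 * T
      + Ct * R + e * k * X + j7)
    (hB : j6 ≤ - e * T + Ct * R - a' * T - Pa + j7)
    (hC : j8 ≤ e * R - Ct * X - a' * Q + s * A * U + 1 / (4 * s) * Pa + k * U)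
    (hUX : U ≤ X) (hZ : 0 ≤ Zz) (hT : 0 ≤ T) (hU : 0 ≤ U) (hPa : 0 ≤ Pa)
    (hdiss : μ * (1 + e) ≤ Ct - e1) (he : 0 ≤ e) (heM : e ≤ eM) (hCb : Cbar ≤ Ct)
    (hm : m ≤ e + a') (hC1 : C1 ≤ η) (he2 : ebar ≤ e2) (hk : 0 ≤ k) (hμ : 0 < μ)
    (hc1 : c1 = Cbar / 2 + μ / 2 - k) (hc1p : 0 < c1) (hsA : s * A ≤ c1 / 4) (hs : 0 < s)
    (hA0 : 0 ≤ A)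
    (hθ : 0 < θ) (hθs : θ ≤ 4 * s) (hθm : θ ≤ m / 4) (hη : η = θ * c1 / 2)
    (hb1 : b ≤ θ * c1 / 2) (hb2 : b ≤ m / 2) (hγ : 0 ≤ γ)
    (hγ1 : K1 + 2 ≤ γ * b) (hγ2 : eM * k + (η - ebar) / 2 + 2 ≤ γ * b)
    (hcc1 : cc ≤ μ / 2) (hcc2 : cc ≤ 1) :
    1 / 2 * (2 * e * e1 * Zz + e ^ 2 * (2 * i1) - (2 * e1 * R + 2 * e * (j4 + j5)) + 2 * j6)
      + 1 / 2 * ((C1 - e2) * X + (Ct - e1) * (-2 * R)) - j7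
      + γ * (1 / 2 * (2 * j6) + 1 / 2 * (C1 * X + Ct * (-2 * R)) - j7
        + θ * (T + j8 + 1 / 2 * (e1 * X + e * (-2 * R)) + 1 / 2 * a' * (2 * Q)))
      ≤ - cc * (e ^ 2 * Zz + X + U + T) := by
  have hX : 0 ≤ X := hU.trans hUX
  have p1 : 1 / 2 * (2 * e * e1 * Zz + e ^ 2 * (2 * i1) - (2 * e1 * R + 2 * e * (j4 + j5)) + 2 * j6)
      + 1 / 2 * ((C1 - e2) * X + (Ct - e1) * (-2 * R)) - j7
      ≤ - (μ / 2) * (e ^ 2 * Zz) + K1 * T + (eM * k + (η - ebar) / 2) * X := by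
    have q1 : μ * (1 + e) * (e * Zz) ≤ (Ct - e1) * (e * Zz) :=
      mul_le_mul_of_nonneg_right hdiss (by positivity)
    have q2 : e * k * X ≤ eM * k * X := by gcongr
    have q3 : (C1 - e2) * X ≤ (η - ebar) * X := by gcongr
    have q4 : 0 ≤ μ * (e * Zz) := by positivity
    linarith
  have p2 : 1 / 2 * (2 * j6) + 1 / 2 * (C1 * X + Ct * (-2 * R)) - j7
        + θ * (T + j8 + 1 / 2 * (e1 * X + e * (-2 * R)) + 1 / 2 * a' * (2 * Q))
      ≤ - b * (T + X) := by
    have q1 : T + j8 + 1 / 2 * (e1 * X + e * (-2 * R)) + 1 / 2 * a' * (2 * Q)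
        ≤ T - 3 / 4 * c1 * X + 1 / (4 * s) * Pa := by
      have r1 : s * A * U ≤ c1 / 4 * X := by
        calc s * A * U ≤ s * A * X := by gcongr
          _ ≤ c1 / 4 * X := by gcongr
      have r2 : k * U ≤ k * X := by gcongr
      have r3 : (Cbar / 2 + μ / 2) * X ≤ (Ct - e1 / 2) * X := by
        apply mul_le_mul_of_nonneg_right _ hX
        have : 0 ≤ μ * e := by positivity
        linarith
      have r4 : c1 * X = (Cbar / 2 + μ / 2 - k) * X := by rw [hc1]
      linarith
    have q2 := mul_le_mul_of_nonneg_left q1 hθ.le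
    have q3 : θ * (1 / (4 * s) * Pa) ≤ Pa := by
      have : θ * (1 / (4 * s)) ≤ 1 := by
        rw [mul_one_div, div_le_one (by positivity)]; exact hθs
      have := mul_le_mul_of_nonneg_right this hPa
      linarith
    have q4 : C1 * X ≤ θ * c1 / 2 * X := by
      rw [← hη]; gcongr
    have q5 : m * T ≤ (e + a') * T := by gcongr
    have q6 : θ * T ≤ m / 4 * T := by gcongr
    have q7 : b * X ≤ θ * c1 / 2 * X := by gcongr
    have q8 : b * T ≤ m / 2 * T := by gcongr
    have q9 : 0 ≤ m * T := mul_nonneg (by linarith) hT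
    linarith
  have p3 := mul_le_mul_of_nonneg_left p2 hγ
  have p4 : (K1 + 2) * T ≤ γ * b * T := by gcongr
  have p5 : (eM * k + (η - ebar) / 2 + 2) * X ≤ γ * b * X := by gcongr
  have p6 : cc * (e ^ 2 * Zz) ≤ μ / 2 * (e ^ 2 * Zz) := by gcongr
  have p7 : cc * X ≤ 1 * X := by gcongr
  have p8 : cc * U ≤ 1 * U := by gcongr
  have p9 : cc * T ≤ 1 * T := by gcongr
  linarith

lemma arith2 (e e1 Ct a' k μ θ γ m c3 Cbar Zz R T X U Q P : ℝ)
    (hUX : U ≤ X) (hZ : 0 ≤ Zz) (hT : 0 ≤ T) (hU : 0 ≤ U)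
    (hR : 2 * (e * R) ≤ e ^ 2 * Zz / 2 + 2 * T) (hQ : - (θ * Q) ≤ T / 4 + θ ^ 2 * U)
    (hP : P ≤ k / 2 * U)
    (hdiss : μ * (1 + e) ≤ Ct - e1) (he : 0 ≤ e) (hCb : Cbar ≤ Ct) (hCk : k ≤ Cbar)
    (hm : m ≤ e + a') (hk : 0 ≤ k) (hμ : 0 < μ)
    (hθ : 0 < θ) (hθm : θ ≤ m / 4) (hγ : 4 ≤ γ) (hγ2 : k / 2 + 1 ≤ γ * (θ * m / 4))
    (hc31 : c3 ≤ 1 / 4) (hc32 : c3 ≤ μ / 2) :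
    c3 * (e ^ 2 * Zz + X + U + T) ≤ 1 / 2 * (e ^ 2 * Zz - 2 * e * R + T) + 1 / 2 * ((Ct - e1) * X)
      - P + γ * (1 / 2 * T + 1 / 2 * (Ct * X) - P + θ * (Q + 1 / 2 * (e * X) + 1 / 2 * a' * U)) := by
  have hX : 0 ≤ X := hU.trans hUX
  have p1 : T / 4 + θ * m / 4 * U ≤
      1 / 2 * T + 1 / 2 * (Ct * X) - P + θ * (Q + 1 / 2 * (e * X) + 1 / 2 * a' * U) := by
    have q1 : k * U ≤ Ct * X := by
      calc k * U ≤ k * X := by gcongr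
        _ ≤ Ct * X := by gcongr; linarith
    have q2 : m * U ≤ e * X + a' * U := by
      have : e * U ≤ e * X := by gcongr
      have : m * U ≤ (e + a') * U := by gcongr
      linarith
    have q3 : θ * (m * U) ≤ θ * (e * X + a' * U) := by gcongr
    have q4 : θ ^ 2 * U ≤ θ * m / 4 * U := by
      gcongr
      nlinarith
    linarith
  have p2 := mul_le_mul_of_nonneg_left p1 (show 0 ≤ γ by linarith)
  have p3 : (k / 2 + 1) * U ≤ γ * (θ * m / 4) * U := by gcongr
  have p4 : 4 * T ≤ γ * T := by gcongr
  have p5 : μ * X ≤ (Ct - e1) * X := by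
    gcongr
    nlinarith
  have p6 : c3 * (e ^ 2 * Zz) ≤ 1 / 4 * (e ^ 2 * Zz) := by gcongr
  have p7 : c3 * X ≤ μ / 2 * X := by gcongr
  have p8 : c3 * U ≤ 1 / 4 * U := by gcongr
  have p9 : c3 * T ≤ 1 / 4 * T := by gcongr
  linarith

lemma arith3 (e e1 Ct a' M θ γ g eM Zz R T X U Q P : ℝ)
    (hZ : 0 ≤ Zz) (hT : 0 ≤ T) (hU : 0 ≤ U) (hX : 0 ≤ X)
    (hR : - (2 * (e * R)) ≤ e ^ 2 * Zz + T) (hQ : 2 * Q ≤ U + T)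
    (hP : - P ≤ M / 2 * U) (hM : 0 ≤ M) (hg : 0 ≤ g) (ha' : 0 ≤ a')
    (h1 : Ct - e1 ≤ 2 * g) (h2 : Ct ≤ 2 * g) (he : 0 ≤ e) (heM : e ≤ eM)
    (hθ : 0 < θ) (hγ : 0 ≤ γ) :
    1 / 2 * (e ^ 2 * Zz - 2 * e * R + T) + 1 / 2 * ((Ct - e1) * X)
      - P + γ * (1 / 2 * T + 1 / 2 * (Ct * X) - P + θ * (Q + 1 / 2 * (e * X) + 1 / 2 * a' * U))
      ≤ (1 + g + M / 2 + γ * (1 + g + M / 2 + θ * (1 + eM + a'))) * (e ^ 2 * Zz + X + U + T) := by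
  set D := e ^ 2 * Zz + X + U + T with hD
  have hz : 0 ≤ e ^ 2 * Zz := by positivity
  have d1 : X ≤ D := by linarith
  have d2 : U ≤ D := by linarith
  have d3 : T ≤ D := by linarith
  have d0 : 0 ≤ D := by linarith
  have p0 : 1 / 2 * (e ^ 2 * Zz - 2 * e * R + T) ≤ D := by linarith
  have p1 : (Ct - e1) * X ≤ 2 * g * D := by
    calc (Ct - e1) * X ≤ 2 * g * X := by gcongr
      _ ≤ 2 * g * D := by gcongr
  have p2 : Ct * X ≤ 2 * g * D := by
    calc Ct * X ≤ 2 * g * X := by gcongr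
      _ ≤ 2 * g * D := by gcongr
  have p3 : M / 2 * U ≤ M / 2 * D := by gcongr
  have p4 : Q + 1 / 2 * (e * X) + 1 / 2 * a' * U ≤ (1 + eM + a') * D := by
    have : e * X ≤ eM * D := by
      calc e * X ≤ eM * X := by gcongr
        _ ≤ eM * D := by have := he.trans heM; gcongr
    have q : a' * U ≤ a' * D := by gcongr
    have : 0 ≤ eM * D := mul_nonneg (he.trans heM) d0
    have : 0 ≤ a' * D := mul_nonneg ha' d0
    linarith
  have p5 := mul_le_mul_of_nonneg_left p4 hθ.le
  have p6 : 1 / 2 * T + 1 / 2 * (Ct * X) - P + θ * (Q + 1 / 2 * (e * X) + 1 / 2 * a' * U)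
    ≤ (1 + g + M / 2 + θ * (1 + eM + a')) * D := by linarith
  have p7 := mul_le_mul_of_nonneg_left p6 hγ
  linarith

lemma aux_cs {f g : ℝ → ℝ} (hf : ContinuousOn f (Icc 0 π)) (hg : ContinuousOn g (Icc 0 π))
    (α β : ℝ) : 0 ≤ α ^ 2 * (∫ x in (0:ℝ)..π, f x ^ 2) + 2 * α * β * (∫ x in (0:ℝ)..π, f x * g x)
      + β ^ 2 * ∫ x in (0:ℝ)..π, g x ^ 2 := by
  have h2 := aux_lin' (fun x => (α * f x + β * g x) ^ 2)
      ![α ^ 2, 2 * α * β, β ^ 2] ![fun x => f x ^ 2, fun x => f x * g x, fun x => g x ^ 2]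
      (by intro i; fin_cases i <;> simp <;> fun_prop)
      (by intro x; simp [Fin.sum_univ_succ]; ring)
  have h3 : 0 ≤ ∫ x in (0:ℝ)..π, (α * f x + β * g x) ^ 2 :=
    intervalIntegral.integral_nonneg pi_pos.le fun x _ => sq_nonneg _
  beta_reduce at h2
  rw [h2] at h3
  simp [Fin.sum_univ_succ, -intervalIntegral.integral_const_mul] at h3
  linarith

lemma aux_P {F F' u : ℝ → ℝ} (k ρ : ℝ) (hFderiv : ∀ z, HasDerivAt F (F' z) z) (hF0 : F 0 = 0)
    (hFk : ∀ z, |z| < ρ → F' z ≤ k) (hu : ContinuousOn u (Icc 0 π))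
    (hb : ∀ x ∈ Icc (0:ℝ) π, |u x| < ρ) :
    ∫ x in (0:ℝ)..π, (∫ z in (0:ℝ)..u x, F z) ≤ k / 2 * ∫ x in (0:ℝ)..π, u x ^ 2 := by
  have hc : Continuous F := continuous_iff_continuousAt.2 fun z => (hFderiv z).continuousAt
  have hP : Continuous fun y => ∫ z in (0:ℝ)..y, F z := by
    refine continuous_iff_continuousAt.2 fun z => ?_
    exact (hc.integral_hasStrictDerivAt 0 z).hasDerivAt.continuousAt
  rw [← intervalIntegral.integral_const_mul]
  apply intervalIntegral.integral_mono_on pi_pos.le (aux_ii (hP.comp_continuousOn hu))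
    (aux_ii (by fun_prop))
  intro x hx
  exact aux_Phi F F' k ρ hFderiv hF0 hFk (u x) (hb x hx)

set_option maxHeartbeats 4000000 in
/-- Theorem 3.1 (uniform exponential-asymptotic stability): if moreover
`sup_(t>0) g(t) < ∞`, then the null solution is uniformly
exponential-asymptotically stable. -/
theorem null_solution_uniformly_exponential_asymptotically_stable
    (ε ε' ε'' C C' F F' : ℝ → ℝ) (a' A τ k ρ μ Cbar εbar ebar : ℝ)
    (hεderiv : ∀ t ∈ Ici (0:ℝ), HasDerivWithinAt ε (ε' t) (Ici 0) t)
    (hε'deriv : ∀ t ∈ Ici (0:ℝ), HasDerivWithinAt ε' (ε'' t) (Ici 0) t)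
    (hε''cont : ContinuousOn ε'' (Ici 0))
    (hεnonneg : ∀ t ∈ Ici (0:ℝ), 0 ≤ ε t)
    (hCderiv : ∀ t ∈ Ici (0:ℝ), HasDerivWithinAt C (C' t) (Ici 0) t)
    (hC'cont : ContinuousOn C' (Ici 0))
    (hFderiv : ∀ z, HasDerivAt F (F' z) z)
    (hF'cont : Continuous F')
    (hF0 : F 0 = 0)
    (hCbar : IsGLB (C '' Ioi (0:ℝ)) Cbar) (hCbarpos : 0 < Cbar)
    (hεbar : IsGLB (ε '' Ioi (0:ℝ)) εbar)
    (hebar : IsGLB (ε'' '' Ioi (0:ℝ)) ebar)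
    (hA : 0 ≤ A) (hτ : 0 ≤ τ) (hk : 0 ≤ k) (hρ : 0 < ρ) (hμ : 0 < μ)
    (hFk : ∀ z, |z| < ρ → F' z ≤ k)
    (hCk : k ≤ Cbar)
    (hdiss : ∀ t ∈ Ici (0:ℝ), μ * (1 + ε t) ≤ C t - ε' t)
    (hmuk : 0 < μ + Cbar / 2 - 2 * k)
    (ha' : 0 ≤ a')
    (ha'ε : 0 < a' + εbar / 2)
    (hC' : (∀ t ∈ Ici (0:ℝ), C' t ≤ 0) ∨ Tendsto C' atTop (nhds 0))
    (hg : ∃ gM, ∀ t ∈ Ioi (0:ℝ), C t - ε' t / 2 + 1 ≤ gM)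
    :
    ∃ κ, 0 ≤ κ ∧ ∃ δ, 0 < δ ∧ ∃ D, 0 < D ∧ ∃ E, 0 < E ∧
      ∀ t₀, κ ≤ t₀ →
        ∀ S : ClassicalSolution ε C F a' t₀,
          (∀ x ∈ Icc (0:ℝ) π, ∀ t ∈ Ici t₀, S.aa x t ≤ A * S.d t ^ τ) →
          S.d t₀ < δ →
          ∀ t, t₀ ≤ t → S.d t ≤ D * Real.exp (-E * (t - t₀)) * S.d t₀ := by
  classical
  obtain ⟨gM, hg⟩ := hg
  -- constants
  have hεbar0 : 0 ≤ εbar := hεbar.2 (by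
    rintro _ ⟨t, ht, rfl⟩
    have ht' : (0:ℝ) < t := ht
    exact hεnonneg t (show (0:ℝ) ≤ t from ht'.le))
  obtain ⟨m, hm⟩ : ∃ m, m = εbar + a' := ⟨_, rfl⟩
  have hmp : 0 < m := by linarith
  obtain ⟨c1, hc1⟩ : ∃ c1, c1 = Cbar / 2 + μ / 2 - k := ⟨_, rfl⟩
  have hc1p : 0 < c1 := by linarith
  obtain ⟨s, hs⟩ : ∃ s, s = c1 / (4 * (A + 1)) := ⟨_, rfl⟩
  have hsp : 0 < s := by rw [hs]; positivity
  have hsA : s * A ≤ c1 / 4 := by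
    have : s * (A + 1) = c1 / 4 := by rw [hs]; field_simp
    linarith
  obtain ⟨θ, hθ, hθm, hθs⟩ : ∃ θ : ℝ, 0 < θ ∧ θ ≤ m / 4 ∧ θ ≤ 4 * s :=
    ⟨min (m / 4) (4 * s), by positivity, min_le_left _ _, min_le_right _ _⟩
  obtain ⟨η, hη⟩ : ∃ η, η = θ * c1 / 2 := ⟨_, rfl⟩
  have hηp : 0 < η := by rw [hη]; positivity
  obtain ⟨κ, hκ1, hκ⟩ : ∃ κ : ℝ, 1 ≤ κ ∧ ∀ t, κ ≤ t → C' t ≤ η := by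
    rcases hC' with h | h
    · exact ⟨1, le_rfl, fun t ht => (h t (show (0:ℝ) ≤ t by linarith)).trans hηp.le⟩
    · have := (h.eventually (gt_mem_nhds hηp))
      obtain ⟨a, ha⟩ := eventually_atTop.1 this
      exact ⟨max 1 a, le_max_left _ _, fun t ht => (ha t ((le_max_right _ _).trans ht)).le⟩
  have hCb : ∀ t, 0 < t → Cbar ≤ C t := fun t ht => hCbar.1 ⟨t, ht, rfl⟩
  have hεb : ∀ t, 0 < t → m ≤ ε t + a' := fun t ht => by
    have := hεbar.1 ⟨t, ht, rfl⟩
    linarith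
  have heb : ∀ t, 0 < t → ebar ≤ ε'' t := fun t ht => hebar.1 ⟨t, ht, rfl⟩
  have hdiss0 : ∀ t, 0 < t → 0 ≤ C t - ε' t := fun t ht => by
    have h1 := hdiss t (le_of_lt ht)
    have h2 := hεnonneg t (le_of_lt ht)
    have : 0 ≤ μ * (1 + ε t) := by positivity
    linarith
  have hG1 : ∀ t, 0 < t → C t - ε' t ≤ 2 * gM := fun t ht => by
    have h1 := hg t ht
    have h2 := hCb t ht
    linarith
  have hG2 : ∀ t, 0 < t → C t ≤ 2 * gM := fun t ht => by
    have h1 := hg t ht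
    have h2 := hdiss0 t ht
    linarith
  have hgM : 0 ≤ gM := by
    have := hG1 1 one_pos
    have := hdiss0 1 one_pos
    linarith
  obtain ⟨eM, heM⟩ : ∃ eM, eM = 2 * gM / μ := ⟨_, rfl⟩
  have heMp : 0 ≤ eM := by rw [heM]; positivity
  have hεM : ∀ t, 0 < t → ε t ≤ eM := fun t ht => by
    rw [heM, le_div_iff₀ hμ]
    have h1 := hdiss t (le_of_lt ht)
    have h2 := hG1 t ht
    linarith
  obtain ⟨M, hM0, hM⟩ : ∃ M : ℝ, 0 ≤ M ∧ ∀ z, |z| < ρ / 2 → - F' z ≤ M := by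
    obtain ⟨M, hM⟩ := (isCompact_Icc (a := -(ρ / 2)) (b := ρ / 2)).exists_bound_of_continuousOn
      hF'cont.continuousOn
    refine ⟨M, (norm_nonneg _).trans (hM 0 ⟨by linarith, by linarith⟩), fun z hz => ?_⟩
    have hz' := abs_lt.1 hz
    exact (neg_le_abs _).trans (hM z ⟨hz'.1.le, hz'.2.le⟩)
  have hFk2 : ∀ z, |z| < ρ / 2 → F' z ≤ k := fun z hz => hFk z (by linarith)
  obtain ⟨K1, hK1⟩ : ∃ K1, K1 = (a' + A) ^ 2 / (2 * μ) := ⟨_, rfl⟩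
  obtain ⟨b, hbp, hb1, hb2⟩ : ∃ b : ℝ, 0 < b ∧ b ≤ θ * c1 / 2 ∧ b ≤ m / 2 :=
    ⟨min (θ * c1 / 2) (m / 2), by positivity, min_le_left _ _, min_le_right _ _⟩
  obtain ⟨γ, hγ4, hγ1, hγ2, hγ3⟩ : ∃ γ : ℝ, 4 ≤ γ ∧ K1 + 2 ≤ γ * b ∧
      eM * k + (η - ebar) / 2 + 2 ≤ γ * b ∧ k / 2 + 1 ≤ γ * (θ * m / 4) := by
    refine ⟨max (max 4 ((K1 + 2) / b)) (max ((eM * k + (η - ebar) / 2 + 2) / b)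
      ((k / 2 + 1) / (θ * m / 4))), ?_, ?_, ?_, ?_⟩
    · exact (le_max_left _ _).trans (le_max_left _ _)
    · rw [← div_le_iff₀ hbp]
      exact (le_max_right _ _).trans (le_max_left _ _)
    · rw [← div_le_iff₀ hbp]
      exact (le_max_left _ _).trans (le_max_right _ _)
    · rw [← div_le_iff₀ (by positivity)]
      exact (le_max_right _ _).trans (le_max_right _ _)
  have hγ0 : 0 ≤ γ := by linarith
  obtain ⟨cc, hccp, hcc1, hcc2⟩ : ∃ cc : ℝ, 0 < cc ∧ cc ≤ μ / 2 ∧ cc ≤ 1 :=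
    ⟨min (μ / 2) 1, by positivity, min_le_left _ _, min_le_right _ _⟩
  obtain ⟨c3, hc3p, hc31, hc32⟩ : ∃ c3 : ℝ, 0 < c3 ∧ c3 ≤ 1 / 4 ∧ c3 ≤ μ / 2 :=
    ⟨min (1 / 4) (μ / 2), by positivity, min_le_left _ _, min_le_right _ _⟩
  obtain ⟨c2, hc2⟩ : ∃ c2, c2 = 1 + gM + M / 2 + γ * (1 + gM + M / 2 + θ * (1 + eM + a')) :=
    ⟨_, rfl⟩
  have hc2p : 0 < c2 := by rw [hc2]; positivity
  obtain ⟨r, hrp, hr1, hr2⟩ : ∃ r : ℝ, 0 < r ∧ r ≤ 1 ∧ r < ρ / 2 :=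
    ⟨min 1 (ρ / 4), by positivity, min_le_left _ _, (min_le_right _ _).trans_lt (by linarith)⟩
  refine ⟨κ, by linarith, r * min 1 (√(c3 / c2)), by positivity, √(c2 / c3), by positivity,
    cc / (2 * c2), by positivity, ?_⟩
  intro t₀ ht₀ S hSa hinit t ht
  have ht0p : 0 < t₀ := by linarith
  have hFc : Continuous F := continuous_iff_continuousAt.2 fun z => (hFderiv z).continuousAt
  obtain ⟨Φ, hΦ⟩ : ∃ Φ : ℝ → ℝ, Φ = fun y => ∫ z in (0:ℝ)..y, F z := ⟨_, rfl⟩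
  have hΦd : ∀ z, HasDerivAt Φ (F z) z := fun z => by
    rw [hΦ]; exact (hFc.integral_hasStrictDerivAt 0 z).hasDerivAt
  have hΦc : Continuous Φ := continuous_iff_continuousAt.2 fun z => (hΦd z).continuousAt
  -- continuity of the data
  have c_u : ContinuousOn (fun p : ℝ × ℝ => S.u p.1 p.2) (Icc 0 π ×ˢ Ici t₀) := S.cont_u
  have c_ux : ContinuousOn (fun p : ℝ × ℝ => S.ux p.1 p.2) (Icc 0 π ×ˢ Ici t₀) := S.cont_ux
  have c_uxx : ContinuousOn (fun p : ℝ × ℝ => S.uxx p.1 p.2) (Icc 0 π ×ˢ Ici t₀) := S.cont_uxx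
  have c_ut : ContinuousOn (fun p : ℝ × ℝ => S.ut p.1 p.2) (Icc 0 π ×ˢ Ici t₀) := S.cont_ut
  have c_utt : ContinuousOn (fun p : ℝ × ℝ => S.utt p.1 p.2) (Icc 0 π ×ˢ Ici t₀) := S.cont_utt
  have c_uxxt : ContinuousOn (fun p : ℝ × ℝ => S.uxxt p.1 p.2) (Icc 0 π ×ˢ Ici t₀) := S.cont_uxxt
  have c_aa : ContinuousOn (fun p : ℝ × ℝ => S.aa p.1 p.2) (Icc 0 π ×ˢ Ici t₀) := S.cont_aa
  have c_Φu : ContinuousOn (fun p : ℝ × ℝ => Φ (S.u p.1 p.2)) (Icc 0 π ×ˢ Ici t₀) :=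
    hΦc.comp_continuousOn c_u
  have c_Fu : ContinuousOn (fun p : ℝ × ℝ => F (S.u p.1 p.2)) (Icc 0 π ×ˢ Ici t₀) :=
    hFc.comp_continuousOn c_u
  have hπm : π ∈ Icc (0:ℝ) π := ⟨pi_pos.le, le_rfl⟩
  -- the scalar functions
  obtain ⟨Zz, hZz⟩ : ∃ f : ℝ → ℝ, f = fun t => ∫ x in (0:ℝ)..π, S.uxx x t ^ 2 := ⟨_, rfl⟩
  obtain ⟨R, hR⟩ : ∃ f : ℝ → ℝ, f = fun t => ∫ x in (0:ℝ)..π, S.uxx x t * S.ut x t := ⟨_, rfl⟩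
  obtain ⟨T, hT⟩ : ∃ f : ℝ → ℝ, f = fun t => ∫ x in (0:ℝ)..π, S.ut x t ^ 2 := ⟨_, rfl⟩
  obtain ⟨X, hX⟩ : ∃ f : ℝ → ℝ, f = fun t => ∫ x in (0:ℝ)..π, S.ux x t ^ 2 := ⟨_, rfl⟩
  obtain ⟨U, hU⟩ : ∃ f : ℝ → ℝ, f = fun t => ∫ x in (0:ℝ)..π, S.u x t ^ 2 := ⟨_, rfl⟩
  obtain ⟨Q, hQ⟩ : ∃ f : ℝ → ℝ, f = fun t => ∫ x in (0:ℝ)..π, S.u x t * S.ut x t := ⟨_, rfl⟩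
  obtain ⟨P, hP⟩ : ∃ f : ℝ → ℝ, f = fun t => ∫ x in (0:ℝ)..π, Φ (S.u x t) := ⟨_, rfl⟩
  have cZ : ContinuousOn Zz (Ici t₀) := by
    rw [hZz]; exact aux_contint (fun x t => S.uxx x t ^ 2) t₀ (by fun_prop)
  have cR : ContinuousOn R (Ici t₀) := by
    rw [hR]; exact aux_contint (fun x t => S.uxx x t * S.ut x t) t₀ (by fun_prop)
  have cT : ContinuousOn T (Ici t₀) := by
    rw [hT]; exact aux_contint (fun x t => S.ut x t ^ 2) t₀ (by fun_prop)
  have cX : ContinuousOn X (Ici t₀) := by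
    rw [hX]; exact aux_contint (fun x t => S.ux x t ^ 2) t₀ (by fun_prop)
  have cU : ContinuousOn U (Ici t₀) := by
    rw [hU]; exact aux_contint (fun x t => S.u x t ^ 2) t₀ (by fun_prop)
  have cQ : ContinuousOn Q (Ici t₀) := by
    rw [hQ]; exact aux_contint (fun x t => S.u x t * S.ut x t) t₀ (by fun_prop)
  have cP : ContinuousOn P (Ici t₀) := by
    rw [hP]; exact aux_contint (fun x t => Φ (S.u x t)) t₀ c_Φu
  have hsub : Ici t₀ ⊆ Ici 0 := Ici_subset_Ici.2 ht0p.le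
  have cε : ContinuousOn ε (Ici t₀) := fun t ht =>
    (hεderiv t (hsub ht)).continuousWithinAt.mono hsub
  have cε' : ContinuousOn ε' (Ici t₀) := fun t ht =>
    (hε'deriv t (hsub ht)).continuousWithinAt.mono hsub
  have cC : ContinuousOn C (Ici t₀) := fun t ht =>
    (hCderiv t (hsub ht)).continuousWithinAt.mono hsub
  -- nonnegativity
  have Z0 : ∀ t, 0 ≤ Zz t := fun t => by
    rw [hZz]; exact intervalIntegral.integral_nonneg pi_pos.le fun x _ => sq_nonneg _
  have T0 : ∀ t, 0 ≤ T t := fun t => by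
    rw [hT]; exact intervalIntegral.integral_nonneg pi_pos.le fun x _ => sq_nonneg _
  have X0 : ∀ t, 0 ≤ X t := fun t => by
    rw [hX]; exact intervalIntegral.integral_nonneg pi_pos.le fun x _ => sq_nonneg _
  have U0 : ∀ t, 0 ≤ U t := fun t => by
    rw [hU]; exact intervalIntegral.integral_nonneg pi_pos.le fun x _ => sq_nonneg _
  have UX : ∀ t, t₀ ≤ t → U t ≤ X t := fun t ht => by
    rw [hU, hX]
    exact aux_wirt (S.hux t ht) (aux_slice c_ux ht) (S.bc0 t ht) (S.bcπ t ht)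
  -- the norm
  have hdeq : ∀ t, t₀ ≤ t → S.d t = √(ε t ^ 2 * Zz t + X t + U t + T t) := by
    intro t ht
    have s1 := aux_slice c_u ht
    have s2 := aux_slice c_ux ht
    have s3 := aux_slice c_uxx ht
    have s4 := aux_slice c_ut ht
    have h2 := aux_lin' (fun x => ε t ^ 2 * S.uxx x t ^ 2 + S.ux x t ^ 2 + S.u x t ^ 2
        + S.ut x t ^ 2)
      ![ε t ^ 2, 1, 1, 1] ![fun x => S.uxx x t ^ 2, fun x => S.ux x t ^ 2, fun x => S.u x t ^ 2,
        fun x => S.ut x t ^ 2]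
      (by intro i; fin_cases i <;> simp <;> fun_prop)
      (by intro x; simp [Fin.sum_univ_succ]; ring)
    beta_reduce at h2
    unfold ClassicalSolution.d
    rw [h2, hZz, hX, hU, hT]
    congr 1
    simp [Fin.sum_univ_succ, -intervalIntegral.integral_const_mul]
    ring
  have hN0 : ∀ t, 0 ≤ ε t ^ 2 * Zz t + X t + U t + T t := fun t => by
    have := Z0 t; have := X0 t; have := U0 t; have := T0 t
    positivity
  have hdsq : ∀ t, t₀ ≤ t → S.d t ^ 2 = ε t ^ 2 * Zz t + X t + U t + T t := fun t ht => by
    rw [hdeq t ht, sq_sqrt (hN0 t)]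
  have hd0 : ∀ t, 0 ≤ S.d t := fun t => Real.sqrt_nonneg _
  have cd : ContinuousOn S.d (Ici t₀) := by
    refine ContinuousOn.congr (f := fun t => √(ε t ^ 2 * Zz t + X t + U t + T t)) ?_ hdeq
    exact ((((cε.pow 2).mul cZ).add cX).add cU |>.add cT).sqrt
  have hsup : ∀ t, t₀ ≤ t → S.d t ≤ r → ∀ x ∈ Icc (0:ℝ) π, |S.u x t| < ρ / 2 := by
    intro t ht hdr x hx
    have h1 := aux_sup (S.hux t ht) (aux_slice c_ux ht) (S.bc0 t ht) x hx
    have h2 : S.u x t ^ 2 ≤ S.d t ^ 2 := by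
      rw [hdsq t ht]
      have := Z0 t; have := T0 t
      have : 0 ≤ ε t ^ 2 * Zz t := by positivity
      simp only [hX, hU]
      linarith
    have h3 := abs_le_of_sq_le_sq h2 (hd0 t)
    exact h3.trans_lt (hdr.trans_lt hr2)
  -- the Liapunov functional
  obtain ⟨V, hV⟩ : ∃ V : ℝ → ℝ, V = fun t =>
    1 / 2 * (ε t ^ 2 * Zz t - 2 * ε t * R t + T t) + 1 / 2 * ((C t - ε' t) * X t) - P t
      + γ * (1 / 2 * T t + 1 / 2 * (C t * X t) - P t
        + θ * (Q t + 1 / 2 * (ε t * X t) + 1 / 2 * a' * U t)) := ⟨_, rfl⟩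
  have cV : ContinuousOn V (Ici t₀) := by
    rw [hV]; fun_prop
  refine aux_ode S.d V t₀ r cc c2 c3 hrp hccp hc2p hc3p hd0 cd cV ?_ ?_ hinit t ht
  · intro t ht hdr
    have htp : 0 < t := by linarith
    have s1 := aux_slice c_u ht
    have s3 := aux_slice c_uxx ht
    have s4 := aux_slice c_ut ht
    have hu := hsup t ht hdr
    have hP1 : P t ≤ k / 2 * U t := by
      rw [hP, hU, hΦ]
      exact aux_P k (ρ / 2) hFderiv hF0 hFk2 s1 hu
    have hP2 : - P t ≤ M / 2 * U t := by
      rw [hP, hU, hΦ]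
      have := aux_P (F := fun z => - F z) (F' := fun z => - F' z) M (ρ / 2)
        (fun z => (hFderiv z).neg) (by simp [hF0]) hM s1 hu
      simpa using this
    rw [hdsq t ht, hV]
    constructor
    · refine arith2 (ε t) (ε' t) (C t) a' k μ θ γ m c3 Cbar (Zz t) (R t) (T t) (X t) (U t) (Q t)
        (P t) (UX t ht) (Z0 t) (T0 t) (U0 t) ?_ ?_ hP1 (hdiss t htp.le) (hεnonneg t htp.le)
        (hCb t htp) hCk (hεb t htp) hk hμ hθ hθm hγ4 hγ3 hc31 hc32
      · have := aux_cs s3 s4 (ε t) (-2)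
        simp only [hR, hZz, hT]
        linarith
      · have := aux_cs s1 s4 θ (1 / 2)
        simp only [hQ, hU, hT]
        linarith
    · rw [hc2]
      refine arith3 (ε t) (ε' t) (C t) a' M θ γ gM eM (Zz t) (R t) (T t) (X t) (U t) (Q t)
        (P t) (Z0 t) (T0 t) (U0 t) (X0 t) ?_ ?_ hP2 hM0 hgM ha' (hG1 t htp) (hG2 t htp)
        (hεnonneg t htp.le) (hεM t htp) hθ hγ0
      · have := aux_cs s3 s4 (ε t) 1
        simp only [hR, hZz, hT]
        linarith
      · have := aux_cs s1 s4 1 (-1)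
        simp only [hQ, hU, hT]
        linarith
  · intro t ht hdr
    have htp : 0 < t := by linarith
    have hu := hsup t ht.le hdr
    obtain ⟨ut0, utπ, w, hw, hwx⟩ := aux_ut S.u S.ux S.uxx S.ut S.uxxt t₀ S.hux S.huxx S.hut S.huxxt
      c_uxx c_uxxt S.bc0 S.bcπ t ht
    have s1 := aux_slice c_u ht.le
    have s2 := aux_slice c_ux ht.le
    have s3 := aux_slice c_uxx ht.le
    have s4 := aux_slice c_ut ht.le
    have s5 := aux_slice c_uxxt ht.le
    have s6 := aux_slice c_utt ht.le
    have s7 := aux_slice c_aa ht.le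
    have haa : ∀ x ∈ Icc (0:ℝ) π, 0 ≤ S.aa x t ∧ S.aa x t ≤ A := by
      intro x hx
      refine ⟨S.aa_nonneg x hx t ht.le, (hSa x hx t ht.le).trans ?_⟩
      have : S.d t ^ τ ≤ 1 := Real.rpow_le_one (hd0 t) (hdr.trans hr1) hτ
      nlinarith
    obtain ⟨J, EA, EB, EC, Pa0⟩ := aux_est (fun x => S.u x t) (fun x => S.ux x t)
      (fun x => S.uxx x t) (fun x => S.ut x t) w (fun x => S.uxxt x t) (fun x => S.utt x t)
      (fun x => S.aa x t) F F' (ε t) (C t) a' A k μ s (S.hux t ht.le) (S.huxx t ht.le) hw hwx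
      s3 s5 s6 s7 hFderiv hF'cont hF0 (S.bc0 t ht.le) (S.bcπ t ht.le) ut0 utπ
      (hεnonneg t htp.le) ha' hμ hsp haa (fun x hx => hFk2 _ (hu x hx))
      (fun x hx => aux_zF2 F F' k (ρ / 2) hFderiv hF0 hFk2 _ (hu x hx)) (fun x hx => S.pde x hx t ht)
    -- derivatives of the scalar functions
    have dZ : HasDerivAt Zz (2 * ∫ x in (0:ℝ)..π, S.uxx x t * S.uxxt x t) t := by
      have := aux_leib (fun x t => S.uxx x t ^ 2) (fun x t => 2 * (S.uxx x t * S.uxxt x t)) t₀ π hπm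
        (by fun_prop) (by fun_prop) (fun x hx t ht => by
          simpa [mul_assoc] using (S.huxxt x hx t ht).fun_pow 2) t ht
      rw [hZz]
      simpa using this
    have dT : HasDerivAt T (2 * ∫ x in (0:ℝ)..π, S.ut x t * S.utt x t) t := by
      have := aux_leib (fun x t => S.ut x t ^ 2) (fun x t => 2 * (S.ut x t * S.utt x t)) t₀ π hπm
        (by fun_prop) (by fun_prop) (fun x hx t ht => by
          simpa [mul_assoc] using (S.hutt x hx t ht).fun_pow 2) t ht
      rw [hT]
      simpa using this
    have dU : HasDerivAt U (2 * Q t) t := by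
      have := aux_leib (fun x t => S.u x t ^ 2) (fun x t => 2 * (S.u x t * S.ut x t)) t₀ π hπm
        (by fun_prop) (by fun_prop) (fun x hx t ht => by
          simpa [mul_assoc] using (S.hut x hx t ht).fun_pow 2) t ht
      rw [hU, hQ]
      simpa using this
    have dR : HasDerivAt R ((∫ x in (0:ℝ)..π, S.ut x t * S.uxxt x t)
        + ∫ x in (0:ℝ)..π, S.uxx x t * S.utt x t) t := by
      have := aux_leib (fun x t => S.uxx x t * S.ut x t)
        (fun x t => S.ut x t * S.uxxt x t + S.uxx x t * S.utt x t) t₀ π hπm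
        (by fun_prop) (by fun_prop) (fun x hx t ht =>
          ((S.huxxt x hx t ht).mul (S.hutt x hx t ht)).congr_deriv (by ring)) t ht
      rw [hR]
      rwa [intervalIntegral.integral_add (aux_ii (by fun_prop)) (aux_ii (by fun_prop))] at this
    have dQ : HasDerivAt Q (T t + ∫ x in (0:ℝ)..π, S.u x t * S.utt x t) t := by
      have := aux_leib (fun x t => S.u x t * S.ut x t)
        (fun x t => S.ut x t ^ 2 + S.u x t * S.utt x t) t₀ π hπm
        (by fun_prop) (by fun_prop) (fun x hx t ht =>
          ((S.hut x hx t ht).mul (S.hutt x hx t ht)).congr_deriv (by ring)) t ht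
      rw [hQ, hT]
      rwa [intervalIntegral.integral_add (aux_ii (by fun_prop)) (aux_ii (by fun_prop))] at this
    have dP : HasDerivAt P (∫ x in (0:ℝ)..π, F (S.u x t) * S.ut x t) t := by
      have := aux_leib (fun x t => Φ (S.u x t))
        (fun x t => F (S.u x t) * S.ut x t) t₀ π hπm c_Φu (c_Fu.mul c_ut)
        (fun x hx t ht => (hΦd _).comp_hasDerivWithinAt t (S.hut x hx t ht)) t ht
      rw [hP]
      exact this
    have dX : HasDerivAt X (-2 * R t) t := by
      have := aux_leib (fun x t => S.u x t * S.uxx x t)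
        (fun x t => S.uxx x t * S.ut x t + S.u x t * S.uxxt x t) t₀ π hπm
        (by fun_prop) (by fun_prop) (fun x hx t ht =>
          ((S.hut x hx t ht).mul (S.huxxt x hx t ht)).congr_deriv (by ring)) t ht
      rw [intervalIntegral.integral_add (aux_ii (by fun_prop)) (aux_ii (by fun_prop)), J] at this
      have h2 := this.neg
      refine (h2.congr_of_eventuallyEq ?_).congr_deriv ?_
      · filter_upwards [Ici_mem_nhds ht] with q hq
        have := aux_parts (S.hux q hq) (S.huxx q hq) (aux_slice c_ux hq) (aux_slice c_uxx hq)
          (S.bc0 q hq) (S.bcπ q hq)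
        simp only [Pi.neg_apply]
        rw [this, hX, neg_neg]
        show (∫ x in (0:ℝ)..π, S.ux x q ^ 2) = ∫ x in (0:ℝ)..π, S.ux x q * S.ux x q
        refine intervalIntegral.integral_congr (fun x _ => ?_)
        exact pow_two _
      · rw [hR]; ring
    have hn : Ici (0:ℝ) ∈ nhds t := Ici_mem_nhds htp
    have dε := (hεderiv t htp.le).hasDerivAt hn
    have dε' := (hε'deriv t htp.le).hasDerivAt hn
    have dC := (hCderiv t htp.le).hasDerivAt hn
    have e1 := (((dε.fun_pow 2).fun_mul dZ).fun_sub ((dε.const_mul 2).fun_mul dR)).fun_add dT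
    have e2 := (dC.fun_sub dε').fun_mul dX
    have e3 := (dQ.fun_add ((dε.fun_mul dX).const_mul (1 / 2))).fun_add (dU.const_mul (1 / 2 * a'))
    have e4 := (((dT.const_mul (1 / 2)).fun_add ((dC.fun_mul dX).const_mul (1 / 2))).fun_sub
      dP).fun_add (e3.const_mul θ)
    have e5 := (((e1.const_mul (1 / 2)).fun_add (e2.const_mul (1 / 2))).fun_sub dP).fun_add
      (e4.const_mul γ)
    refine ⟨_, by rw [hV]; exact e5, ?_⟩
    rw [hdsq t ht.le]
    rw [← hK1] at EA
    have := arith1 (ε t) (ε' t) (ε'' t) (C t) (C' t) a' A k μ s θ γ m c1 b K1 eM η ebar Cbar cc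
      (Zz t) (R t) (T t) (X t) (U t) (Q t) (∫ x in (0:ℝ)..π, S.aa x t * S.ut x t ^ 2)
      (∫ x in (0:ℝ)..π, S.uxx x t * S.uxxt x t) (∫ x in (0:ℝ)..π, S.ut x t * S.uxxt x t)
      (∫ x in (0:ℝ)..π, S.uxx x t * S.utt x t) (∫ x in (0:ℝ)..π, S.ut x t * S.utt x t)
      (∫ x in (0:ℝ)..π, F (S.u x t) * S.ut x t) (∫ x in (0:ℝ)..π, S.u x t * S.utt x t)
      (by simp only [hZz, hT, hR, hX]; exact EA) (by simp only [hT, hR]; exact EB)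
      (by simp only [hX, hR, hU, hQ]; exact EC) (UX t ht.le) (Z0 t) (T0 t) (U0 t) Pa0
      (hdiss t htp.le) (hεnonneg t htp.le) (hεM t htp) (hCb t htp) (hεb t htp)
      (hκ t (by linarith)) (heb t htp) hk hμ hc1 hc1p hsA hsp hA hθ hθs hθm hη hb1 hb2 hγ0
      hγ1 hγ2 hcc1 hcc2
    refine le_trans (le_of_eq ?_) this
    push_cast
    ring
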